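/- For every real x with 0 < x < 1/(12√3), with u(x) := (1/(24x))·(1 + 2·sin((2/3)·arcsin(12√3·x) − π/6)) the closed-form spherical generating function of the cubic matrix model, one has u(x) > 0 and log u(x) = Σ_{n≥1} [Γ(3n/2 + 1)/(3n·n!·Γ(n/2 + 1))]·(8x)^n, the series on the right converging to log u(x), where Γ is the real Gamma function. -/

import Mathlib

open Real

/-- The closed-form spherical generating function `u⁽⁰⁾` of the cubic matrix model. -/
noncomputable def cubicSphericalU (x : ℝ) : ℝ :=
  1 / (24 * x) * (1 + 2 * Real.sin (2 / 3 * Real.arcsin (12 * Real.sqrt 3 * x) - Real.pi / 6))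

/-- A power series with at most quadratically growing coefficients converges on `(-1, 1)`. -/
lemma summable_mul_pow_of_abs_le_sq {a : ℕ → ℝ} (ha : ∀ n, |a n| ≤ ((n : ℝ) + 2) ^ 2) {t : ℝ}
    (ht : |t| < 1) : Summable fun n => a n * t ^ n := by
  have h2 := summable_pow_mul_geometric_of_norm_lt_one 2 (r := |t|) (by simpa using ht)
  have h1 := summable_pow_mul_geometric_of_norm_lt_one 1 (r := |t|) (by simpa using ht)
  have h0 := summable_pow_mul_geometric_of_norm_lt_one 0 (r := |t|) (by simpa using ht)
  refine Summable.of_norm_bounded ((h2.add (h1.mul_left 4)).add (h0.mul_left 4)) fun n => ?_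
  rw [norm_mul, norm_pow, Real.norm_eq_abs, Real.norm_eq_abs]
  calc |a n| * |t| ^ n ≤ ((n : ℝ) + 2) ^ 2 * |t| ^ n := by gcongr; exact ha n
    _ = _ := by ring

/-- Termwise differentiation of a power series with at most linearly growing coefficients. -/
lemma hasDerivAt_tsum_mul_pow {a : ℕ → ℝ} (ha : ∀ n, |a n| ≤ (n : ℝ) + 1) {t : ℝ}
    (ht : |t| < 1) :
    HasDerivAt (fun s => ∑' n, a n * s ^ n) (∑' n : ℕ, ((n : ℝ) + 1) * a (n + 1) * t ^ n) t := by
  have hquad : ∀ n : ℕ, |(n + 1 : ℝ) * abs (a (n + 1))| ≤ ((n : ℝ) + 2) ^ 2 := fun n => by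
    have h := ha (n + 1)
    push_cast at h
    have hn : (0 : ℝ) ≤ n := n.cast_nonneg
    rw [abs_mul, abs_abs, abs_of_nonneg (by positivity)]
    nlinarith [abs_nonneg (a (n + 1))]
  obtain ⟨r, htr, hr⟩ := exists_between ht
  have hr0 : 0 ≤ r := (abs_nonneg t).trans htr.le
  have hbound : Summable fun n : ℕ => |a n| * ((n : ℝ) * r ^ (n - 1)) := by
    rw [← summable_nat_add_iff 1]
    refine (summable_mul_pow_of_abs_le_sq hquad (by rwa [abs_of_nonneg hr0])).congr fun n => ?_
    push_cast
    ring
  have hlin : ∀ n : ℕ, |a n| ≤ ((n : ℝ) + 2) ^ 2 := fun n => by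
    have hn : (0 : ℝ) ≤ n := n.cast_nonneg
    nlinarith [ha n]
  have hmem : ∀ s ∈ Metric.ball (0 : ℝ) r, |s| ≤ r := fun s hs => by
    simpa using (Metric.mem_ball.1 hs).le
  have htm : t ∈ Metric.ball (0 : ℝ) r := by simpa using htr
  have hle : ∀ n : ℕ, ∀ s ∈ Metric.ball (0 : ℝ) r,
      ‖a n * ((n : ℝ) * s ^ (n - 1))‖ ≤ |a n| * ((n : ℝ) * r ^ (n - 1)) := fun n s hs => by
    rw [norm_mul, norm_mul, norm_pow, Real.norm_eq_abs, Real.norm_eq_abs, Real.norm_eq_abs,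
      Nat.abs_cast]
    have := hmem s hs
    gcongr
  have key := hasDerivAt_tsum_of_isPreconnected hbound Metric.isOpen_ball
    (convex_ball (0 : ℝ) r).isPreconnected
    (fun n s _ => (hasDerivAt_pow n s).const_mul (a n)) hle htm
    (summable_mul_pow_of_abs_le_sq hlin ht) htm
  refine key.congr_deriv ?_
  rw [(Summable.of_norm_bounded hbound fun n => hle n t htm).tsum_eq_zero_add]
  simp only [Nat.cast_zero, zero_mul, mul_zero, zero_add]
  refine tsum_congr fun n => ?_
  push_cast
  ring

/-- The coefficients `binom(3n/2, n)` rescaled so that the power series has radius `1`. -/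
noncomputable def cubicCoeff (n : ℕ) : ℝ :=
  Real.Gamma (3 * (n : ℝ) / 2 + 1) / ((Nat.factorial n : ℝ) * Real.Gamma ((n : ℝ) / 2 + 1)) *
    (2 / (3 * √3)) ^ n

lemma cubicCoeff_zero : cubicCoeff 0 = 1 := by
  simp [cubicCoeff]

lemma cubicCoeff_one : cubicCoeff 1 = 1 / √3 := by
  have h : Real.Gamma (3 / 2 + 1) = 3 / 2 * Real.Gamma (3 / 2) :=
    Real.Gamma_add_one (by norm_num)
  have hp : (0 : ℝ) < Real.Gamma (3 / 2) := Real.Gamma_pos_of_pos (by norm_num)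
  have h' : (1 : ℝ) / 2 + 1 = 3 / 2 := by norm_num
  simp only [cubicCoeff, Nat.cast_one, mul_one, h', h, Nat.factorial_one, one_mul, pow_one]
  field_simp

lemma cubicCoeff_nonneg (n : ℕ) : 0 ≤ cubicCoeff n := by
  have h1 : 0 < Real.Gamma (3 * (n : ℝ) / 2 + 1) := Real.Gamma_pos_of_pos (by positivity)
  have h2 : 0 < Real.Gamma ((n : ℝ) / 2 + 1) := Real.Gamma_pos_of_pos (by positivity)
  unfold cubicCoeff
  positivity

lemma cubicCoeff_add_two (n : ℕ) :
    ((n : ℝ) + 1) * ((n : ℝ) + 2) * cubicCoeff (n + 2) =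
      ((n : ℝ) ^ 2 + 2 * n + 8 / 9) * cubicCoeff n := by
  have hn : (0 : ℝ) ≤ n := n.cast_nonneg
  have h2 : 0 < Real.Gamma ((n : ℝ) / 2 + 1) := Real.Gamma_pos_of_pos (by positivity)
  have e1 : Real.Gamma (3 * ((n : ℝ) + 2) / 2 + 1) = (3 * (n : ℝ) / 2 + 3) *
      ((3 * (n : ℝ) / 2 + 2) * ((3 * (n : ℝ) / 2 + 1) * Real.Gamma (3 * (n : ℝ) / 2 + 1))) := by
    rw [← Real.Gamma_add_one (by positivity), show 3 * (n : ℝ) / 2 + 1 + 1 = 3 * n / 2 + 2 by ring,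
      ← Real.Gamma_add_one (by positivity), show 3 * (n : ℝ) / 2 + 2 + 1 = 3 * n / 2 + 3 by ring,
      ← Real.Gamma_add_one (by positivity)]
    congr 1
    ring
  have e2 : Real.Gamma (((n : ℝ) + 2) / 2 + 1) =
      ((n : ℝ) / 2 + 1) * Real.Gamma ((n : ℝ) / 2 + 1) := by
    rw [← Real.Gamma_add_one (by positivity)]
    congr 1
    ring
  have e3 : (2 / (3 * √3)) ^ 2 = (4 : ℝ) / 27 := by
    rw [div_pow, mul_pow, Real.sq_sqrt (by norm_num)]
    norm_num
  simp only [cubicCoeff, Nat.cast_add, Nat.cast_ofNat, e1, e2, Nat.factorial_succ, pow_add _ n 2,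
    e3]
  push_cast
  field_simp
  ring

lemma cubicCoeff_le_one (n : ℕ) : cubicCoeff n ≤ 1 := by
  induction n using Nat.twoStepInduction with
  | zero => exact cubicCoeff_zero.le
  | one =>
    rw [cubicCoeff_one, div_le_one (by positivity)]
    exact Real.one_le_sqrt.2 (by norm_num)
  | more n ih _ =>
    have hn : (0 : ℝ) ≤ n := n.cast_nonneg
    have h := cubicCoeff_add_two n
    have h0 := cubicCoeff_nonneg n
    by_contra! hlt
    nlinarith [mul_pos (show (0 : ℝ) < (n + 1) * (n + 2) by positivity) (sub_pos.2 hlt)]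

lemma abs_cubicCoeff_le_one (n : ℕ) : |cubicCoeff n| ≤ 1 := by
  rw [abs_of_nonneg (cubicCoeff_nonneg n)]
  exact cubicCoeff_le_one n

lemma abs_succ_mul_cubicCoeff_le (n : ℕ) :
    |((n : ℝ) + 1) * cubicCoeff (n + 1)| ≤ (n : ℝ) + 1 := by
  have hn : (0 : ℝ) ≤ n := n.cast_nonneg
  rw [abs_mul, abs_of_nonneg (by positivity : (0 : ℝ) ≤ n + 1)]
  exact mul_le_of_le_one_right (by positivity) (abs_cubicCoeff_le_one _)

lemma abs_cubicCoeff_div_le_one (n : ℕ) : |cubicCoeff n / (3 * n)| ≤ 1 := by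
  rcases n.eq_zero_or_pos with rfl | hn
  · simp
  · have hn : (1 : ℝ) ≤ n := by exact_mod_cast hn
    rw [abs_of_nonneg (div_nonneg (cubicCoeff_nonneg n) (by positivity)),
      div_le_one (by positivity)]
    linarith [cubicCoeff_le_one n]

/-- The sum of the rescaled series. -/
noncomputable def cubicSum (t : ℝ) : ℝ := ∑' n, cubicCoeff n * t ^ n

/-- The derivative of `cubicSum`. -/
noncomputable def cubicSumDeriv (t : ℝ) : ℝ :=
  ∑' n : ℕ, ((n : ℝ) + 1) * cubicCoeff (n + 1) * t ^ n

/-- The second derivative of `cubicSum`. -/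
noncomputable def cubicSumDerivTwo (t : ℝ) : ℝ :=
  ∑' n : ℕ, ((n : ℝ) + 1) * (((n + 1 : ℕ) : ℝ) + 1) * cubicCoeff (n + 2) * t ^ n

/-- The rescaled logarithmic series. -/
noncomputable def cubicLogSum (t : ℝ) : ℝ := ∑' n : ℕ, cubicCoeff n / (3 * n) * t ^ n

lemma hasDerivAt_cubicSum {t : ℝ} (ht : |t| < 1) : HasDerivAt cubicSum (cubicSumDeriv t) t :=
  hasDerivAt_tsum_mul_pow
    (fun n => (abs_cubicCoeff_le_one n).trans (by linarith [n.cast_nonneg (α := ℝ)])) ht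

lemma hasDerivAt_cubicSumDeriv {t : ℝ} (ht : |t| < 1) :
    HasDerivAt cubicSumDeriv (cubicSumDerivTwo t) t := by
  refine (hasDerivAt_tsum_mul_pow abs_succ_mul_cubicCoeff_le ht).congr_deriv ?_
  exact tsum_congr fun n => by ring

lemma hasDerivAt_cubicLogSum {t : ℝ} (ht : |t| < 1) :
    HasDerivAt cubicLogSum (∑' n : ℕ, cubicCoeff (n + 1) / 3 * t ^ n) t := by
  refine (hasDerivAt_tsum_mul_pow (fun n => (abs_cubicCoeff_div_le_one n).trans
    (by linarith [n.cast_nonneg (α := ℝ)])) ht).congr_deriv ?_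
  refine tsum_congr fun n => ?_
  push_cast
  field_simp

lemma summable_cubicCoeff {t : ℝ} (ht : |t| < 1) : Summable fun n => cubicCoeff n * t ^ n :=
  summable_mul_pow_of_abs_le_sq (fun n => (abs_cubicCoeff_le_one n).trans
    (by nlinarith [n.cast_nonneg (α := ℝ)])) ht

lemma mul_tsum_cubicCoeff_succ {t : ℝ} (ht : |t| < 1) :
    t * ∑' n : ℕ, cubicCoeff (n + 1) / 3 * t ^ n = (cubicSum t - 1) / 3 := by
  rw [cubicSum, (summable_cubicCoeff ht).tsum_eq_zero_add, cubicCoeff_zero, pow_zero, mul_one,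
    add_sub_cancel_left, ← tsum_mul_left, ← tsum_div_const]
  exact tsum_congr fun n => by ring

/-- The hypergeometric differential equation satisfied by `cubicSum`. -/
lemma cubicSum_ode {t : ℝ} (ht : |t| < 1) :
    (1 - t ^ 2) * cubicSumDerivTwo t = 3 * t * cubicSumDeriv t + 8 / 9 * cubicSum t := by
  have hs0 := summable_cubicCoeff ht
  have hs1 : Summable fun n : ℕ => (n : ℝ) * cubicCoeff n * t ^ n :=
    summable_mul_pow_of_abs_le_sq (fun n => by
      have hn := n.cast_nonneg (α := ℝ)
      rw [abs_mul, abs_of_nonneg hn]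
      nlinarith [abs_cubicCoeff_le_one n]) ht
  have hs2 : Summable fun n : ℕ => (n : ℝ) * ((n : ℝ) - 1) * cubicCoeff n * t ^ n :=
    summable_mul_pow_of_abs_le_sq (fun n => by
      have hn := n.cast_nonneg (α := ℝ)
      have hb : |(n : ℝ) * ((n : ℝ) - 1)| ≤ ((n : ℝ) + 2) ^ 2 :=
        abs_le.2 ⟨by nlinarith, by nlinarith⟩
      rw [abs_mul]
      exact (mul_le_of_le_one_right (abs_nonneg _) (abs_cubicCoeff_le_one n)).trans hb) ht
  have e1 : t * cubicSumDeriv t = ∑' n : ℕ, (n : ℝ) * cubicCoeff n * t ^ n := by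
    rw [hs1.tsum_eq_zero_add, cubicSumDeriv, ← tsum_mul_left]
    simp only [Nat.cast_zero, zero_mul, zero_add]
    refine tsum_congr fun n => ?_
    push_cast
    ring
  have e2 : t ^ 2 * cubicSumDerivTwo t =
      ∑' n : ℕ, (n : ℝ) * ((n : ℝ) - 1) * cubicCoeff n * t ^ n := by
    rw [← hs2.sum_add_tsum_nat_add 2, cubicSumDerivTwo, ← tsum_mul_left]
    simp only [Finset.sum_range_succ, Finset.sum_range_zero, Nat.cast_zero, zero_mul, zero_add,
      Nat.cast_one, sub_self, mul_zero]
    refine tsum_congr fun n => ?_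
    push_cast
    ring
  have e3 : cubicSumDerivTwo t = (∑' n : ℕ, (n : ℝ) * ((n : ℝ) - 1) * cubicCoeff n * t ^ n) +
      3 * (∑' n : ℕ, (n : ℝ) * cubicCoeff n * t ^ n) + 8 / 9 * cubicSum t := by
    rw [cubicSum, ← tsum_mul_left, ← tsum_mul_left, ← hs2.tsum_add (hs1.mul_left 3),
      ← (hs2.add (hs1.mul_left 3)).tsum_add (hs0.mul_left _), cubicSumDerivTwo]
    refine tsum_congr fun n => ?_
    have h := cubicCoeff_add_two n
    push_cast
    linear_combination t ^ n * h
  rw [sub_mul, e2, one_mul, mul_assoc, e1]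
  linarith [e3]

lemma abs_sin_lt_one {θ : ℝ} (h0 : 0 ≤ θ) (h1 : θ < π / 2) : |Real.sin θ| < 1 := by
  have hc : 0 < Real.cos θ := Real.cos_pos_of_mem_Ioo ⟨by linarith [Real.pi_pos], h1⟩
  rw [← sq_lt_one_iff_abs_lt_one]
  nlinarith [Real.sin_sq_add_cos_sq θ]

lemma cubicSum_zero : cubicSum 0 = 1 := by
  rw [cubicSum, tsum_eq_single 0 fun n hn => by simp [hn]]
  simp [cubicCoeff_zero]

lemma cubicSumDeriv_zero : cubicSumDeriv 0 = 1 / √3 := by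
  rw [cubicSumDeriv, tsum_eq_single 0 fun n hn => by simp [hn]]
  simp [cubicCoeff_one]

lemma cubicLogSum_zero : cubicLogSum 0 = 0 := by
  rw [cubicLogSum, tsum_eq_single 0 fun n hn => by simp [hn]]
  simp

/-- A function with vanishing derivative on `[0, θ]` takes equal values at the endpoints. -/
lemma eq_of_hasDerivAt_zero {f f' : ℝ → ℝ} {θ : ℝ} (hθ : 0 < θ)
    (hc : ∀ y ∈ Set.Icc 0 θ, ContinuousAt f y)
    (hf : ∀ y ∈ Set.Ioo 0 θ, HasDerivAt f (f' y) y) (h0 : ∀ y ∈ Set.Ioo 0 θ, f' y = 0) :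
    f θ = f 0 := by
  obtain ⟨c, hcm, h⟩ := exists_hasDerivAt_eq_slope f f' hθ
    (fun y hy => (hc y hy).continuousWithinAt) hf
  rw [h0 c hcm, sub_zero, eq_comm, div_eq_zero_iff] at h
  rcases h with h | h
  · exact sub_eq_zero.1 h
  · exact absurd h hθ.ne'

/-- Closed form of `cubicSum` in terms of the angle. -/
lemma cubicSum_sin_mul_cos {θ : ℝ} (h0 : 0 < θ) (h1 : θ < π / 2) :
    cubicSum (Real.sin θ) * Real.cos θ = 2 * Real.cos (π / 3 - θ / 3) := by
  set H : ℝ → ℝ := fun y => cubicSum (Real.sin y) * Real.cos y with hH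
  set K : ℝ → ℝ := fun y =>
    cubicSumDeriv (Real.sin y) * Real.cos y ^ 2 - cubicSum (Real.sin y) * Real.sin y with hK
  have habs : ∀ y ∈ Set.Icc 0 θ, |Real.sin y| < 1 := fun y hy =>
    abs_sin_lt_one hy.1 (hy.2.trans_lt h1)
  have dH : ∀ y ∈ Set.Icc 0 θ, HasDerivAt H (K y) y := fun y hy => by
    have d := (hasDerivAt_cubicSum (habs y hy)).comp y (Real.hasDerivAt_sin y)
    refine (d.mul (Real.hasDerivAt_cos y)).congr_deriv ?_
    simp only [hK, Function.comp_apply]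
    ring
  have dK : ∀ y ∈ Set.Icc 0 θ, HasDerivAt K (-(H y) / 9) y := fun y hy => by
    have d0 := (hasDerivAt_cubicSum (habs y hy)).comp y (Real.hasDerivAt_sin y)
    have d1 := (hasDerivAt_cubicSumDeriv (habs y hy)).comp y (Real.hasDerivAt_sin y)
    refine ((d1.mul ((Real.hasDerivAt_cos y).pow 2)).sub
      (d0.mul (Real.hasDerivAt_sin y))).congr_deriv ?_
    have ode := cubicSum_ode (habs y hy)
    rw [← Real.cos_sq'] at ode
    simp only [hH, Function.comp_apply, Pi.pow_apply]
    push_cast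
    linear_combination Real.cos y * ode
  have hd3 : ∀ y : ℝ, HasDerivAt (fun y : ℝ => y / 3) (1 / 3) y := fun y =>
    (hasDerivAt_id y).div_const 3
  have dA : ∀ y ∈ Set.Icc 0 θ,
      HasDerivAt (fun y => H y * Real.cos (y / 3) - 3 * K y * Real.sin (y / 3)) 0 y :=
    fun y hy => by
      refine (((dH y hy).mul (hd3 y).cos).sub
        (((dK y hy).const_mul 3).mul (hd3 y).sin)).congr_deriv ?_
      ring
  have dB : ∀ y ∈ Set.Icc 0 θ,
      HasDerivAt (fun y => H y * Real.sin (y / 3) + 3 * K y * Real.cos (y / 3)) 0 y :=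
    fun y hy => by
      refine (((dH y hy).mul (hd3 y).sin).add
        (((dK y hy).const_mul 3).mul (hd3 y).cos)).congr_deriv ?_
      ring
  have eA := eq_of_hasDerivAt_zero h0 (fun y hy => (dA y hy).continuousAt)
    (fun y hy => dA y (Set.Ioo_subset_Icc_self hy)) fun _ _ => rfl
  have eB := eq_of_hasDerivAt_zero h0 (fun y hy => (dB y hy).continuousAt)
    (fun y hy => dB y (Set.Ioo_subset_Icc_self hy)) fun _ _ => rfl
  have hH0 : H 0 = 1 := by simp [hH, cubicSum_zero]
  have hK0 : 3 * K 0 = √3 := by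
    simp only [hK, Real.sin_zero, Real.cos_zero, cubicSumDeriv_zero]
    field_simp
    simp
  simp only [zero_div, Real.sin_zero, Real.cos_zero, mul_zero, mul_one, sub_zero, zero_add, hH0,
    hK0] at eA eB
  have hfin : H θ = Real.cos (θ / 3) + √3 * Real.sin (θ / 3) := by
    linear_combination Real.cos (θ / 3) * eA + Real.sin (θ / 3) * eB -
      H θ * Real.sin_sq_add_cos_sq (θ / 3)
  rw [Real.cos_sub, Real.cos_pi_div_three, Real.sin_pi_div_three]
  linear_combination hfin

/-- Closed form of `cubicLogSum` in terms of the angle. -/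
lemma cubicLogSum_sin {θ : ℝ} (h0 : 0 < θ) (h1 : θ < π / 2) :
    cubicLogSum (Real.sin θ) = -Real.log (2 / √3 * Real.sin (π / 3 - θ / 3)) := by
  have hpos : ∀ y ∈ Set.Icc 0 θ, 0 < Real.sin (π / 3 - y / 3) := fun y hy =>
    Real.sin_pos_of_pos_of_lt_pi (by linarith [hy.2, Real.pi_pos])
      (by linarith [hy.1, Real.pi_pos])
  have hd3 : ∀ y : ℝ, HasDerivAt (fun y : ℝ => π / 3 - y / 3) (-(1 / 3)) y := fun y =>
    ((hasDerivAt_id y).div_const 3).const_sub _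
  have d : ∀ y ∈ Set.Icc 0 θ, HasDerivAt
      (fun y => cubicLogSum (Real.sin y) + Real.log (2 / √3 * Real.sin (π / 3 - y / 3)))
      ((∑' n : ℕ, cubicCoeff (n + 1) / 3 * Real.sin y ^ n) * Real.cos y -
        Real.cos (π / 3 - y / 3) / (3 * Real.sin (π / 3 - y / 3))) y := fun y hy => by
    have hp := hpos y hy
    have dL := (hasDerivAt_cubicLogSum (abs_sin_lt_one hy.1 (hy.2.trans_lt h1))).comp y
      (Real.hasDerivAt_sin y)
    refine (dL.add (((hd3 y).sin.const_mul (2 / √3)).log (by positivity))).congr_deriv ?_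
    field_simp
    ring
  have key := eq_of_hasDerivAt_zero h0 (fun y hy => (d y hy).continuousAt)
    (fun y hy => d y (Set.Ioo_subset_Icc_self hy)) fun y hy => by
      have hp := hpos y (Set.Ioo_subset_Icc_self hy)
      have hy1 : y < π / 2 := hy.2.trans h1
      have hs : 0 < Real.sin y :=
        Real.sin_pos_of_pos_of_lt_pi hy.1 (by linarith [Real.pi_pos])
      have hm := mul_tsum_cubicCoeff_succ (abs_sin_lt_one hy.1.le hy1)
      have hc := cubicSum_sin_mul_cos hy.1 hy1
      have e : y = π - 3 * (π / 3 - y / 3) := by ring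
      have es : Real.sin y =
          3 * Real.sin (π / 3 - y / 3) - 4 * Real.sin (π / 3 - y / 3) ^ 3 := by
        conv_lhs => rw [e, Real.sin_pi_sub, Real.sin_three_mul]
      have ec : Real.cos y =
          -(4 * Real.cos (π / 3 - y / 3) ^ 3 - 3 * Real.cos (π / 3 - y / 3)) := by
        conv_lhs => rw [e, Real.cos_pi_sub, Real.cos_three_mul]
      have hsc := Real.sin_sq_add_cos_sq (π / 3 - y / 3)
      rw [sub_eq_zero, eq_div_iff (by positivity)]
      refine mul_left_cancel₀ hs.ne' ?_
      generalize (∑' n : ℕ, cubicCoeff (n + 1) / 3 * Real.sin y ^ n) = T at *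
      generalize cubicSum (Real.sin y) = G at *
      generalize Real.sin (π / 3 - y / 3) = S at *
      generalize Real.cos (π / 3 - y / 3) = C at *
      linear_combination 3 * Real.cos y * S * hm + S * hc - C * es - S * ec + 4 * S * C * hsc
  simp only [Real.sin_zero, cubicLogSum_zero, zero_div, sub_zero, zero_add,
    Real.sin_pi_div_three] at key
  rw [show 2 / √3 * (√3 / 2) = 1 by field_simp, Real.log_one] at key
  linarith

/-- The spherical generating function in terms of the angle. -/
lemma cubicSphericalU_eq {x : ℝ} (hx0 : 0 < x) (hx : 12 * √3 * x < 1) :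
    cubicSphericalU x =
      (2 / √3 * Real.sin (π / 3 - Real.arcsin (12 * √3 * x) / 3))⁻¹ := by
  have ht0 : 0 < 12 * √3 * x := by positivity
  have hsin := Real.sin_arcsin (by linarith) hx.le
  have hθ0 := Real.arcsin_pos.2 ht0
  have hθ1 := Real.arcsin_lt_pi_div_two.2 hx
  unfold cubicSphericalU
  generalize Real.arcsin (12 * √3 * x) = θ at *
  have hp : 0 < Real.sin (π / 3 - θ / 3) :=
    Real.sin_pos_of_pos_of_lt_pi (by linarith) (by linarith)
  have e1 : Real.sin (2 / 3 * θ - π / 6) = 1 - 2 * Real.sin (π / 3 - θ / 3) ^ 2 := by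
    rw [show 2 / 3 * θ - π / 6 = π / 2 - 2 * (π / 3 - θ / 3) by ring, Real.sin_pi_div_two_sub,
      Real.cos_two_mul, Real.cos_sq']
    ring
  have e2 : Real.sin θ =
      3 * Real.sin (π / 3 - θ / 3) - 4 * Real.sin (π / 3 - θ / 3) ^ 3 := by
    rw [← Real.sin_three_mul, ← Real.sin_pi_sub]
    congr 1
    ring
  have h3 : √3 ^ 2 = 3 := Real.sq_sqrt (by norm_num)
  rw [e1]
  generalize Real.sin (π / 3 - θ / 3) = S at *
  have hx24 : √3 * (24 * x) = 2 * S * (1 + 2 * (1 - 2 * S ^ 2)) := by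
    linear_combination 2 * e2 - 2 * hsin
  rw [eq_comm, inv_eq_iff_eq_inv, one_div, mul_inv, inv_inv]
  have hq : 1 + 2 * (1 - 2 * S ^ 2) ≠ 0 := by
    intro h
    rw [h, mul_zero] at hx24
    have : 0 < √3 * (24 * x) := by positivity
    linarith
  field_simp
  linear_combination -hx24

/-- For `0 < x < 1/(12√3)`, `u(x) > 0` and
`log u(x) = Σ_{n≥1} [Γ(3n/2 + 1)/(3n·n!·Γ(n/2 + 1))]·(8x)ⁿ`. -/
theorem cubicSphericalU_log_series (x : ℝ) (hx0 : 0 < x)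
    (hx : x < 1 / (12 * Real.sqrt 3)) :
    0 < cubicSphericalU x ∧
      HasSum
        (fun n : ℕ =>
          Real.Gamma (3 * ((n : ℝ) + 1) / 2 + 1) /
              ((3 * ((n : ℝ) + 1)) * (Nat.factorial (n + 1) : ℝ) *
                Real.Gamma (((n : ℝ) + 1) / 2 + 1)) *
            (8 * x) ^ (n + 1))
        (Real.log (cubicSphericalU x)) := by
  have h3 : (0 : ℝ) < √3 := by positivity
  have ht1 : 12 * √3 * x < 1 := by
    rwa [lt_div_iff₀ (by positivity), mul_comm] at hx
  have ht0 : 0 < 12 * √3 * x := by positivity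
  have hθ0 := Real.arcsin_pos.2 ht0
  have hθ1 := Real.arcsin_lt_pi_div_two.2 ht1
  have hp : 0 < Real.sin (π / 3 - Real.arcsin (12 * √3 * x) / 3) :=
    Real.sin_pos_of_pos_of_lt_pi (by linarith) (by linarith)
  rw [cubicSphericalU_eq hx0 ht1]
  refine ⟨by positivity, ?_⟩
  rw [Real.log_inv, ← cubicLogSum_sin hθ0 hθ1, Real.sin_arcsin (by linarith) ht1.le]
  have hsum : Summable fun n : ℕ => cubicCoeff n / (3 * n) * (12 * √3 * x) ^ n :=
    summable_mul_pow_of_abs_le_sq (fun n => (abs_cubicCoeff_div_le_one n).trans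
      (by nlinarith [n.cast_nonneg (α := ℝ)])) (by rwa [abs_of_pos ht0])
  have hs := (hasSum_nat_add_iff' 1).2 hsum.hasSum
  simp only [Finset.sum_range_one, Nat.cast_zero, mul_zero, div_zero, zero_mul, sub_zero] at hs
  refine hs.congr_fun fun n => ?_
  have e8 : 8 * x = 2 / (3 * √3) * (12 * √3 * x) := by
    field_simp
    norm_num
  rw [e8, mul_pow, cubicCoeff]
  push_cast
  field_simp
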